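/- arXiv:math/9908098 — 2 statements merged into one kernel-verified Lean document; each statement's English description precedes it below -/
import Mathlib

section
/- Let G be a subgroup of GL(n, ℝ) which is connected in the subspace topology and which is not solvable as an abstract group. Then for every natural number k, G contains a free subgroup of rank k; that is, there exists an injective group homomorphism from the free group on k generators into G. -/
/-- Orbits of a connected group acting linearly are irreducible with respect to linear subspaces:
if finitely many subspaces cover an orbit, then one of them contains it. -/
theorem Representation.orbit_le_of_finset_cover {G E : Type*} [Group G] [TopologicalSpace G]
    [ConnectedSpace G] [AddCommGroup E] [Module ℂ E] [TopologicalSpace E] [IsTopologicalAddGroup E]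
    [ContinuousSMul ℂ E] [T2Space E] [FiniteDimensional ℂ E] (L : Representation ℂ G E)
    (hL : ∀ v, Continuous fun g => L g v) (e : E) (s : Finset (Submodule ℂ E))
    (hs : ∀ g, ∃ W ∈ s, L g e ∈ W) : ∃ W ∈ s, ∀ g, L g e ∈ W := by
  classical
  let Small : ℕ → Set G → Prop := fun d S => ∃ t : Finset (Submodule ℂ E),
    (∀ W ∈ t, Module.finrank ℂ W < d) ∧ ∀ g ∈ S, ∃ W ∈ t, L g e ∈ W
  have hex : ∃ d, Small d Set.univ :=
    ⟨Module.finrank ℂ E + 1, s, fun W _ => Nat.lt_succ_of_le W.finrank_le, fun g _ => hs g⟩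
  obtain ⟨k, hk⟩ : ∃ k, Nat.find hex = k + 1 := by
    refine Nat.exists_eq_succ_of_ne_zero fun h0 => ?_
    obtain ⟨t, ht, ht'⟩ := Nat.find_spec hex
    obtain ⟨W, hW, -⟩ := ht' 1 (Set.mem_univ _)
    exact absurd (ht W hW) (by simp [h0])
  have hnot : ¬ Small k Set.univ := Nat.find_min hex (by omega)
  obtain ⟨t, ht, hcov⟩ := Nat.find_spec hex
  rw [hk] at ht
  obtain ⟨V, hVt, hV⟩ : ∃ V ∈ t, ¬ Small k {g | L g e ∈ V} := by
    by_contra! hcon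
    choose! c hc hc' using hcon
    refine hnot ⟨t.biUnion c, fun W hW => ?_, fun g _ => ?_⟩
    · obtain ⟨V, hV, hW⟩ := Finset.mem_biUnion.1 hW
      exact hc V hV W hW
    · obtain ⟨V, hV, hg⟩ := hcov g (Set.mem_univ _)
      obtain ⟨W, hW, hgW⟩ := hc' V hV g hg
      exact ⟨W, Finset.mem_biUnion.2 ⟨V, hV, hW⟩, hgW⟩
  -- a subspace of dimension at most `k` with a big trace on the orbit lies in one of any cover
  have key : ∀ (V : Submodule ℂ E) (u : Finset (Submodule ℂ E)), Module.finrank ℂ V ≤ k →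
      ¬ Small k {g | L g e ∈ V} → (∀ g, ∃ W ∈ u, L g e ∈ W) → ∃ W ∈ u, V ≤ W := by
    intro V u hVk hV hu
    by_contra! hcon
    refine hV ⟨u.image (V ⊓ ·), ?_, fun g hg => ?_⟩
    · simp only [Finset.mem_image, forall_exists_index, and_imp, forall_apply_eq_imp_iff₂]
      intro W hW
      exact (Submodule.finrank_lt_finrank_of_lt (inf_lt_left.2 (hcon W hW))).trans_le hVk
    · obtain ⟨W, hW, hgW⟩ := hu g
      exact ⟨V ⊓ W, Finset.mem_image_of_mem _ hW, hg, hgW⟩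
  have hinj : ∀ g, Function.Injective (L g) := fun g =>
    Function.LeftInverse.injective (g := L g⁻¹) fun x => by simp
  have hVk : Module.finrank ℂ V ≤ k := Nat.lt_succ_iff.1 (ht V hVt)
  have hrank : ∀ g (V : Submodule ℂ E),
      Module.finrank ℂ (V.map (L g)) = Module.finrank ℂ V := fun g V =>
    (Submodule.equivMapOfInjective _ (hinj g) V).finrank_eq.symm
  have hbig : ∀ g, ¬ Small k {h | L h e ∈ V.map (L g)} := by
    rintro g ⟨u, hu, hu'⟩
    refine hV ⟨u.image (Submodule.map (L g⁻¹)), ?_, fun h hh => ?_⟩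
    · simp only [Finset.mem_image, forall_exists_index, and_imp, forall_apply_eq_imp_iff₂]
      exact fun W hW => (hrank _ W).trans_lt (hu W hW)
    · obtain ⟨W, hW, hgW⟩ := hu' (g * h) ⟨L h e, hh, by simp⟩
      exact ⟨_, Finset.mem_image_of_mem _ hW, L (g * h) e, hgW, by simp⟩
  have hVfin : Module.finrank ℂ V = k := by
    refine le_antisymm hVk (not_lt.1 fun hlt => hV ⟨{V}, by simpa using hlt, by simp⟩)
  have htrans : ∀ g, ∃ W ∈ t, V.map (L g) ≤ W := fun g =>
    key _ t ((hrank g V).trans_le hVk) (hbig g) fun g => hcov g (Set.mem_univ _)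
  -- the stabiliser of `V` is clopen
  have hclosed : ∀ W : Submodule ℂ E, IsClosed {g | V.map (L g) ≤ W} := by
    intro W
    have : {g | V.map (L g) ≤ W} = ⋂ v ∈ V, (fun g => L g v) ⁻¹' (W : Set E) := by
      ext g
      simp [SetLike.le_def]
    rw [this]
    exact isClosed_biInter fun v _ => W.closed_of_finiteDimensional.preimage (hL v)
  have heq : ∀ g, ∀ W ∈ t, V.map (L g) ≤ W → V.map (L g) = W := fun g W hW hle =>
    Submodule.eq_of_le_of_finrank_le hle (by rw [hrank, hVfin]; exact Nat.lt_succ_iff.1 (ht W hW))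
  have hVt' : {g | V.map (L g) ≤ V} = (⋃ W ∈ t.erase V, {g | V.map (L g) ≤ W})ᶜ := by
    ext g
    simp only [Set.mem_ofPred_eq, Set.mem_compl_iff, Set.mem_iUnion, not_exists]
    constructor
    · intro h W hW hle
      obtain ⟨hne, hWt⟩ := Finset.mem_erase.1 hW
      exact hne ((heq g W hWt hle).symm.trans (heq g V hVt h))
    · intro h
      obtain ⟨W, hW, hle⟩ := htrans g
      by_cases hWV : W = V
      · exact hWV ▸ hle
      · exact absurd hle (h W (Finset.mem_erase.2 ⟨hWV, hW⟩))
  have hopen : IsOpen {g | V.map (L g) ≤ V} := by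
    rw [hVt', isOpen_compl_iff]
    exact (t.erase V).finite_toSet.isClosed_biUnion fun W _ => hclosed W
  have huniv : {g | V.map (L g) ≤ V} = Set.univ :=
    IsClopen.eq_univ ⟨hclosed V, hopen⟩ ⟨1, by simp [Module.End.one_eq_id]⟩
  obtain ⟨h, hh⟩ : ∃ h, L h e ∈ V := by
    by_contra! hcon
    exact hV ⟨∅, by simp, fun g hg => (hcon g hg).elim⟩
  obtain ⟨W, hW, hVW⟩ := key V s hVk hV hs
  refine ⟨W, hW, fun g => hVW ?_⟩
  have := (Set.eq_univ_iff_forall.1 huniv (g * h⁻¹)) ⟨L h e, hh, rfl⟩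
  simpa using this

theorem Matrix.range_mulVecLin_eq_of_rank_le {F n : Type*} [Field F] [Fintype n] [DecidableEq n]
    {A B : Matrix n n F} (h : A.rank ≤ (A * B).rank) :
    LinearMap.range (A * B).mulVecLin = LinearMap.range A.mulVecLin := by
  refine Submodule.eq_of_le_of_finrank_le ?_ h
  rw [Matrix.mulVecLin_mul]
  exact LinearMap.range_comp_le_range _ _

theorem Matrix.mul_mul_ne_zero_of_rank_le {F n : Type*} [Field F] [Fintype n] [DecidableEq n]
    {C A B : Matrix n n F} (h : A.rank ≤ (A * B).rank) (hCA : C * A ≠ 0) : C * (A * B) ≠ 0 := by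
  intro h0
  apply hCA
  have h1 : LinearMap.range (A * B).mulVecLin ≤ LinearMap.ker C.mulVecLin := by
    rw [LinearMap.range_le_ker_iff, ← Matrix.mulVecLin_mul, h0, Matrix.mulVecLin_zero]
  rw [Matrix.range_mulVecLin_eq_of_rank_le h, LinearMap.range_le_ker_iff,
    ← Matrix.mulVecLin_mul] at h1
  apply Matrix.toLin'.injective
  rw [Matrix.toLin'_apply', h1, map_zero]

/-- Ping-pong by ranks. Every group element `g` has nonzero limits, matrices `A` with `Lim g A`,
multiplicatively in `g`; limits of `1` are invertible but some element has a singular limit.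
If elements of a subgroup `G₀` can be put in general position, then `G` contains free groups. -/
theorem exists_injective_freeGroup_of_limits {F n G : Type*} [Field F] [Fintype n] [DecidableEq n]
    [Group G] (Lim : G → Matrix n n F → Prop)
    (hmul : ∀ g h A B, Lim g A → Lim h B → Lim (g * h) (A * B))
    (hex : ∀ g, ∃ A, A ≠ 0 ∧ Lim g A)
    (hone : ∀ A, A ≠ 0 → Lim 1 A → A.rank = Fintype.card n)
    (hsing : ∃ g A, Lim g A ∧ A ≠ 0 ∧ A.rank < Fintype.card n)
    (G₀ : Subgroup G) (R : G₀ →* Matrix n n F) (hR : ∀ z : G₀, Lim z (R z))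
    (hgen : ∀ (s : Finset G₀) (t : Finset (Matrix n n F)), (∀ X ∈ t, X ≠ 0) →
      ∃ y, ∀ x ∈ s, ∀ X ∈ t, ∀ Y ∈ t, X * R (x⁻¹ * y) * Y ≠ 0 ∧ X * R (y⁻¹ * x) * Y ≠ 0)
    (k : ℕ) : ∃ f : FreeGroup (Fin k) →* G, Function.Injective f := by
  classical
  have hr : ∃ r, ∃ g A, Lim g A ∧ A ≠ 0 ∧ A.rank = r := by
    obtain ⟨g, A, h1, h2, -⟩ := hsing
    exact ⟨_, g, A, h1, h2, rfl⟩
  obtain ⟨a, A, haA, hA0, hAr⟩ := Nat.find_spec hr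
  set r := Nat.find hr
  have hmin : ∀ g B, Lim g B → B ≠ 0 → r ≤ B.rank := fun g B h1 h2 =>
    Nat.find_min' hr ⟨g, B, h1, h2, rfl⟩
  have hrlt : r < Fintype.card n := by
    obtain ⟨g, B, h1, h2, h3⟩ := hsing
    exact (hmin g B h1 h2).trans_lt h3
  obtain ⟨A', hA'0, haA'⟩ := hex a⁻¹
  -- an element `g` such that both `g` and `g⁻¹` have limits of minimal rank
  obtain ⟨g, B, hB⟩ : ∃ (g : G) (B : Bool → Matrix n n F), ∀ b, Lim (if b then g else g⁻¹) (B b) ∧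
      B b ≠ 0 ∧ (B b).rank ≤ r := by
    obtain ⟨y, hy⟩ := hgen {1} {A, A'} (by simp [hA0, hA'0])
    obtain ⟨hy1, hy2⟩ := hy 1 (by simp) A (by simp) A' (by simp)
    simp only [inv_one, one_mul, mul_one] at hy1 hy2
    refine ⟨a * y * a⁻¹, fun b => if b then A * R y * A' else A * R y⁻¹ * A', ?_⟩
    rintro (_ | _)
    · refine ⟨?_, by simpa using hy2, ?_⟩
      · have := hmul _ _ _ _ (hmul _ _ _ _ haA (hR y⁻¹)) haA'
        simpa [mul_assoc] using this
      · simp only [Bool.false_eq_true, if_false]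
        rw [Matrix.mul_assoc, ← hAr]
        exact Matrix.rank_mul_le_left _ _
    · refine ⟨?_, by simpa using hy1, ?_⟩
      · simpa using hmul _ _ _ _ (hmul _ _ _ _ haA (hR y)) haA'
      · simp only [if_true]
        rw [Matrix.mul_assoc, ← hAr]
        exact Matrix.rank_mul_le_left _ _
  let rel : G₀ → G₀ → Prop := fun x y => ∀ b c,
    B b * R (x⁻¹ * y) * B c ≠ 0 ∧ B b * R (y⁻¹ * x) * B c ≠ 0
  have : Std.Symm rel := ⟨fun x y h b c => (h b c).symm⟩
  obtain ⟨z, -, hz⟩ := exists_seq_of_forall_finset_exists' (fun _ : G₀ => True) rel fun s _ => by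
    obtain ⟨y, hy⟩ := hgen s (Finset.univ.image B) (by simpa using ⟨(hB true).2.1, (hB false).2.1⟩)
    exact ⟨y, trivial, fun x hx b c => hy x hx _ (Finset.mem_image_of_mem _ (Finset.mem_univ _)) _
      (Finset.mem_image_of_mem _ (Finset.mem_univ _))⟩
  obtain ⟨ι, hι⟩ : ∃ ι : Fin k × Bool → ℕ, Function.Injective ι :=
    ⟨_, (Encodable.encode_injective (α := Fin k × Bool))⟩
  let x : Fin k → G := fun i => z (ι (i, true)) * g * (z (ι (i, false)))⁻¹
  let C : Fin k × Bool → Matrix n n F := fun l =>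
    R (z (ι l)) * B l.2 * R (z (ι (l.1, !l.2)))⁻¹
  have hC : ∀ l, Lim (cond l.2 (x l.1) (x l.1)⁻¹) (C l) := by
    rintro ⟨i, b⟩
    have := hmul _ _ _ _ (hmul _ _ _ _ (hR (z (ι (i, b)))) (hB b).1) (hR (z (ι (i, !b)))⁻¹)
    cases b <;> simpa [C, x, mul_assoc] using this
  have hRinv : ∀ z, R z * R z⁻¹ = 1 ∧ R z⁻¹ * R z = 1 := fun z => by
    simp [← map_mul]
  have hC0 : ∀ l, C l ≠ 0 := fun l h0 => (hB l.2).2.1 <| by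
    have : R (z (ι l))⁻¹ * C l * R (z (ι (l.1, !l.2))) = B l.2 := by
      simp only [C, ← Matrix.mul_assoc, (hRinv _).2, one_mul]
      rw [Matrix.mul_assoc, (hRinv _).2, mul_one]
    rw [← this, h0]; simp
  have hCr : ∀ l, (C l).rank ≤ r := fun l => by
    refine (Matrix.rank_mul_le_left _ _).trans ((Matrix.rank_mul_le_right _ _).trans (hB l.2).2.2)
  have hCC : ∀ l l', (l.1 = l'.1 → l.2 = l'.2) → C l * C l' ≠ 0 := by
    intro l l' hl h0
    have hne : ι (l.1, !l.2) ≠ ι l' := by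
      intro h
      have := hι h
      obtain rfl : (l.1, !l.2) = l' := this
      simp at hl
    apply (hz hne l.2 l'.2).1
    have : R (z (ι l))⁻¹ * (C l * C l') * R (z (ι (l'.1, !l'.2))) =
        B l.2 * R ((z (ι (l.1, !l.2)))⁻¹ * z (ι l')) * B l'.2 := by
      simp only [C, ← Matrix.mul_assoc, (hRinv _).2, one_mul, map_mul]
      rw [Matrix.mul_assoc _ (R (z (ι (l'.1, !l'.2)))⁻¹), (hRinv _).2, mul_one]
    rw [← this, h0]; simp
  -- products of limits along reduced words do not vanish
  have hword : ∀ (L : List (Fin k × Bool)) (l : Fin k × Bool), FreeGroup.IsReduced (l :: L) →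
      C l * (L.map C).prod ≠ 0 ∧
        Lim ((l :: L).map fun l => cond l.2 (x l.1) (x l.1)⁻¹).prod (C l * (L.map C).prod) := by
    intro L
    induction L with
    | nil => intro l _; simpa using ⟨hC0 l, hC l⟩
    | cons l' L ih =>
      intro l hl
      obtain ⟨hl1, hl2⟩ := FreeGroup.isReduced_cons_cons.1 hl
      obtain ⟨h1, h2⟩ := ih l' hl2
      refine ⟨?_, ?_⟩
      · rw [List.map_cons, List.prod_cons]
        exact Matrix.mul_mul_ne_zero_of_rank_le ((hCr l').trans (hmin _ _ h2 h1)) (hCC l l' hl1)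
      · rw [List.map_cons, List.prod_cons, List.map_cons, List.prod_cons]
        exact hmul _ _ _ _ (hC l) h2
  refine ⟨FreeGroup.lift x, (injective_iff_map_eq_one _).2 fun w hw => ?_⟩
  rw [← FreeGroup.toWord_eq_nil_iff]
  have hred := FreeGroup.isReduced_toWord (x := w)
  rw [← FreeGroup.mk_toWord (x := w), FreeGroup.lift_mk] at hw
  cases hL : w.toWord with
  | nil => rfl
  | cons l L =>
    rw [hL] at hw hred
    obtain ⟨h1, h2⟩ := hword L l hred
    rw [hw] at h2
    have h3 := hone _ h1 h2
    have h4 := (Matrix.rank_mul_le_left (C l) (L.map C).prod).trans (hCr l)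
    omega

/-- `A` is the reduction of a scalar multiple of `M` with entries in the valuation ring `O`. -/
def Matrix.IsScaledReduction {K n : Type*} [Field K] (O : ValuationSubring K) (M : Matrix n n K)
    (A : Matrix n n (IsLocalRing.ResidueField O)) : Prop :=
  ∃ c : K, c ≠ 0 ∧ ∃ N : Matrix n n O, N.map O.subtype = c • M ∧ N.map (IsLocalRing.residue O) = A

namespace Matrix.IsScaledReduction

variable {K n : Type*} [Field K] [Fintype n] {O : ValuationSubring K}
  {M M' : Matrix n n K} {A A' : Matrix n n (IsLocalRing.ResidueField O)}

theorem mul (h : IsScaledReduction O M A) (h' : IsScaledReduction O M' A') :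
    IsScaledReduction O (M * M') (A * A') := by
  obtain ⟨c, hc, N, hN, rfl⟩ := h
  obtain ⟨c', hc', N', hN', rfl⟩ := h'
  refine ⟨c * c', mul_ne_zero hc hc', N * N', ?_, Matrix.map_mul⟩
  rw [Matrix.map_mul, hN, hN', Matrix.smul_mul, Matrix.mul_smul, smul_smul]

theorem exists_ne_zero (O : ValuationSubring K) (hM : M ≠ 0) :
    ∃ A, A ≠ 0 ∧ IsScaledReduction O M A := by
  obtain ⟨i₀, j₀, h₀⟩ : ∃ i j, M i j ≠ 0 := by
    by_contra! h
    exact hM (Matrix.ext h)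
  obtain ⟨⟨i, j⟩, -, hij⟩ := Finset.exists_max_image (Finset.univ : Finset (n × n))
    (fun p => O.valuation (M p.1 p.2)) ⟨(i₀, j₀), Finset.mem_univ _⟩
  have hne : M i j ≠ 0 := by
    intro h
    have := hij (i₀, j₀) (Finset.mem_univ _)
    rw [h, map_zero, le_zero_iff, map_eq_zero] at this
    exact h₀ this
  have hmem : ∀ a b, (M i j)⁻¹ * M a b ∈ O := by
    intro a b
    rw [← O.valuation_le_one_iff, map_mul, map_inv₀]
    have := hij (a, b) (Finset.mem_univ _)
    have hv : O.valuation (M i j) ≠ 0 := by simpa using hne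
    rw [inv_mul_le_iff₀ (zero_lt_iff.2 hv), mul_one]
    exact this
  let N : Matrix n n O := Matrix.of fun a b => ⟨_, hmem a b⟩
  refine ⟨N.map (IsLocalRing.residue O), fun h => ?_, (M i j)⁻¹, inv_ne_zero hne, N, ?_, rfl⟩
  · have h1 : N i j = 1 := Subtype.ext (inv_mul_cancel₀ hne)
    have := congrFun (congrFun h i) j
    simp [h1] at this
  · ext a b
    simp [N]

variable [DecidableEq n]

theorem rank_of_one (hA : A ≠ 0) (h : IsScaledReduction O (1 : Matrix n n K) A) :
    A.rank = Fintype.card n := by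
  obtain ⟨c, hc, N, hN, rfl⟩ := h
  rcases isEmpty_or_nonempty n with hn | ⟨⟨i⟩⟩
  · exact absurd (Subsingleton.elim _ _) hA
  have hc : c = O.subtype (N i i) := by
    simpa using (congrFun (congrFun hN i) i).symm
  have hN' : N = N i i • (1 : Matrix n n O) := by
    apply Matrix.map_injective (f := O.subtype) Subtype.val_injective
    change N.map O.subtype = (N i i • (1 : Matrix n n O)).map O.subtype
    rw [hN, hc]
    ext a b
    by_cases hab : a = b <;> simp [hab]
  have hred : N.map (IsLocalRing.residue O) =
      (IsLocalRing.residue O (N i i)) • (1 : Matrix n n (IsLocalRing.ResidueField O)) := by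
    conv_lhs => rw [hN']
    ext a b
    by_cases hab : a = b <;> simp [hab]
  rw [hred] at hA ⊢
  have h0 : IsLocalRing.residue O (N i i) ≠ 0 := by
    intro h
    rw [h, zero_smul] at hA
    exact hA rfl
  refine Matrix.rank_of_isUnit _ ?_
  rw [Matrix.isUnit_iff_isUnit_det, Matrix.det_smul, Matrix.det_one, mul_one]
  exact (pow_ne_zero _ h0).isUnit

theorem rank_lt (hM : M.trace ^ Fintype.card n / M.det ∉ O) (h : IsScaledReduction O M A) :
    A.rank < Fintype.card n := by
  refine lt_of_le_of_ne A.rank_le_card_width fun hr => hM ?_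
  have hA : IsUnit A := by
    rw [← Matrix.mulVec_surjective_iff_isUnit]
    exact LinearMap.range_eq_top.1 (Submodule.eq_top_of_finrank_eq (S := A.mulVecLin.range)
      (by rw [Module.finrank_fintype_fun_eq_card]; exact hr))
  obtain ⟨c, hc, N, hN, rfl⟩ := h
  have hdet : IsUnit N.det := by
    rw [← IsLocalRing.residue_ne_zero_iff_isUnit, RingHom.map_det]
    exact ((Matrix.isUnit_iff_isUnit_det _).1 hA).ne_zero
  obtain ⟨u, hu⟩ := hdet
  have h1 : (O.subtype N.det) = c ^ Fintype.card n * M.det := by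
    rw [RingHom.map_det, RingHom.mapMatrix_apply, hN, Matrix.det_smul]
  have h2 : (O.subtype N.trace) = c * M.trace := by
    rw [AddMonoidHom.map_trace O.subtype, hN, Matrix.trace_smul, smul_eq_mul]
  have h3 : M.trace ^ Fintype.card n / M.det = O.subtype (N.trace ^ Fintype.card n * ↑u⁻¹) := by
    have h4 : O.subtype (↑u⁻¹ : O) * (c ^ Fintype.card n * M.det) = 1 := by
      rw [← h1, ← hu, ← map_mul, Units.inv_mul, map_one]
    have h5 : M.det ≠ 0 := by
      rintro h; simp [h] at h4
    rw [map_mul, map_pow, h2, div_eq_iff h5, mul_pow]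
    linear_combination (-M.trace ^ Fintype.card n) * h4
  rw [h3]
  exact (N.trace ^ Fintype.card n * ↑u⁻¹).2

end Matrix.IsScaledReduction

/-- A proper subspace of matrices over a subfield spans a proper subspace of matrices. -/
theorem Submodule.exists_ne_top_of_subfield {K n : Type*} [Field K] [Fintype n] [DecidableEq n]
    (K₀ : Subfield K) (W₀ : Submodule K₀ (Matrix n n K₀)) (hW₀ : W₀ ≠ ⊤) :
    ∃ W : Submodule K (Matrix n n K), W ≠ ⊤ ∧ ∀ Z ∈ W₀, Z.map K₀.subtype ∈ W := by
  obtain ⟨ψ, hψ, hle⟩ := Submodule.exists_le_ker_of_lt_top W₀ hW₀.lt_top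
  let Ψ : Matrix n n K →ₗ[K] K := ∑ i, ∑ j,
    (K₀.subtype (ψ (Matrix.single i j 1))) • Matrix.entryLinearMap K K i j
  have hΨ : ∀ Z : Matrix n n K₀, Ψ (Z.map K₀.subtype) = K₀.subtype (ψ Z) := by
    intro Z
    conv_rhs => rw [Matrix.matrix_eq_sum_single Z]
    simp only [Ψ, LinearMap.sum_apply, LinearMap.smul_apply, Matrix.entryLinearMap_apply,
      Matrix.map_apply, smul_eq_mul, map_sum]
    refine Finset.sum_congr rfl fun i _ => Finset.sum_congr rfl fun j _ => ?_
    rw [← map_mul, mul_comm, ← smul_eq_mul, ← map_smul, Matrix.smul_single, smul_eq_mul, mul_one]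
  refine ⟨LinearMap.ker Ψ, fun h => hψ (LinearMap.ext fun Z => ?_), fun Z hZ => ?_⟩
  · have h1 : Z.map K₀.subtype ∈ LinearMap.ker Ψ := h ▸ Submodule.mem_top
    rw [LinearMap.mem_ker, hΨ] at h1
    exact K₀.subtype_injective (h1.trans (map_zero _).symm)
  · rw [LinearMap.mem_ker, hΨ, LinearMap.mem_ker.1 (hle hZ), map_zero]

/-- In a connected irreducible matrix group, a dense set contains elements avoiding finitely many
proper subspaces of matrices, also after translation and inversion. -/
theorem exists_mem_dense_forall_notMem {G n : Type*} [Group G] [TopologicalSpace G]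
    [IsTopologicalGroup G] [ConnectedSpace G] [Fintype n] [DecidableEq n]
    (ρ : G →* Matrix n n ℂ) (hρ : Continuous ρ) (hspan : Submodule.span ℂ (Set.range ρ) = ⊤)
    {D : Set G} (hD : Dense D) (s : Finset G) (t : Finset (Submodule ℂ (Matrix n n ℂ)))
    (ht : ∀ W ∈ t, W ≠ ⊤) :
    ∃ y ∈ D, ∀ x ∈ s, ∀ W ∈ t, ρ (x⁻¹ * y) ∉ W ∧ ρ (y⁻¹ * x) ∉ W := by
  classical
  by_contra! hcon
  let L : Representation ℂ G (Matrix n n ℂ × Matrix n n ℂ) :=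
    { toFun g := (LinearMap.mulLeft ℂ (ρ g)).prodMap (LinearMap.mulRight ℂ (ρ g⁻¹))
      map_one' := by ext <;> simp
      map_mul' g h := by ext <;> simp [mul_assoc] }
  have hL : ∀ g v, L g v = (ρ g * v.1, v.2 * ρ g⁻¹) := fun g v => rfl
  let W₁ : G → Submodule ℂ (Matrix n n ℂ) → Submodule ℂ (Matrix n n ℂ × Matrix n n ℂ) :=
    fun x W => W.comap (LinearMap.mulLeft ℂ (ρ x⁻¹) ∘ₗ LinearMap.fst ℂ _ _)
  let W₂ : G → Submodule ℂ (Matrix n n ℂ) → Submodule ℂ (Matrix n n ℂ × Matrix n n ℂ) :=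
    fun x W => W.comap (LinearMap.mulRight ℂ (ρ x) ∘ₗ LinearMap.snd ℂ _ _)
  have hW₁ : ∀ x W g, L g (1, 1) ∈ W₁ x W ↔ ρ (x⁻¹ * g) ∈ W := by
    intro x W g
    simp [W₁, hL]
  have hW₂ : ∀ x W g, L g (1, 1) ∈ W₂ x W ↔ ρ (g⁻¹ * x) ∈ W := by
    intro x W g
    simp [W₂, hL]
  let S : Finset (Submodule ℂ (Matrix n n ℂ × Matrix n n ℂ)) :=
    (s ×ˢ t).image (fun p => W₁ p.1 p.2) ∪ (s ×ˢ t).image (fun p => W₂ p.1 p.2)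
  have hLc : ∀ v, Continuous fun g => L g v := by
    intro v
    simp only [hL]
    fun_prop
  have hclosed : IsClosed (⋃ W ∈ S, (fun g => L g (1, 1)) ⁻¹' (W : Set _)) :=
    S.finite_toSet.isClosed_biUnion fun W _ =>
      W.closed_of_finiteDimensional.preimage (hLc _)
  have hDsub : D ⊆ ⋃ W ∈ S, (fun g => L g (1, 1)) ⁻¹' (W : Set _) := by
    intro y hy
    obtain ⟨x, hx, W, hW, h⟩ := hcon y hy
    simp only [Set.mem_iUnion, Set.mem_preimage, SetLike.mem_coe]
    by_cases h1 : ρ (x⁻¹ * y) ∈ W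
    · exact ⟨W₁ x W, Finset.mem_union_left _ (Finset.mem_image.2
        ⟨(x, W), Finset.mem_product.2 ⟨hx, hW⟩, rfl⟩), (hW₁ _ _ _).2 h1⟩
    · exact ⟨W₂ x W, Finset.mem_union_right _ (Finset.mem_image.2
        ⟨(x, W), Finset.mem_product.2 ⟨hx, hW⟩, rfl⟩), (hW₂ _ _ _).2 (h h1)⟩
  have hcover : ∀ g, ∃ W ∈ S, L g (1, 1) ∈ W := by
    intro g
    have := hclosed.closure_subset_iff.2 hDsub (hD.closure_eq ▸ Set.mem_univ g)
    simpa using this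
  obtain ⟨W', hW', hall⟩ := L.orbit_le_of_finset_cover hLc (1, 1) S hcover
  obtain ⟨W, hW, hW'⟩ : ∃ W ∈ t, ∀ g, ρ g ∈ W := by
    rcases Finset.mem_union.1 hW' with h | h
    · obtain ⟨⟨x, W⟩, hp, rfl⟩ := Finset.mem_image.1 h
      refine ⟨W, (Finset.mem_product.1 hp).2, fun g => ?_⟩
      have := (hW₁ _ _ _).1 (hall (x * g))
      rwa [inv_mul_cancel_left] at this
    · obtain ⟨⟨x, W⟩, hp, rfl⟩ := Finset.mem_image.1 h
      refine ⟨W, (Finset.mem_product.1 hp).2, fun g => ?_⟩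
      have := (hW₂ _ _ _).1 (hall (x * g⁻¹))
      simpa [mul_assoc] using this
  refine ht W hW (top_le_iff.1 (hspan ▸ Submodule.span_le.2 ?_))
  rintro _ ⟨g, rfl⟩
  exact hW' g

/-- In a connected irreducible matrix group of degree at least two, the projectively invariant
function `tr ^ n / det` is not constant. -/
theorem exists_trace_pow_div_det_ne {G n : Type*} [Group G] [TopologicalSpace G]
    [IsTopologicalGroup G] [ConnectedSpace G] [Fintype n] [DecidableEq n] [Nontrivial n]
    (ρ : G →* Matrix n n ℂ) (hρ : Continuous ρ) (hspan : Submodule.span ℂ (Set.range ρ) = ⊤) :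
    ∃ g, (ρ g).trace ^ Fintype.card n / (ρ g).det ≠
      (ρ 1).trace ^ Fintype.card n / (ρ 1).det := by
  by_contra! hcon
  set m := Fintype.card n with hm
  have hm0 : (m : ℂ) ≠ 0 := by simp [hm]
  have hdet : ∀ g, (ρ g).det ≠ 0 := by
    intro g h
    have : (ρ g * ρ g⁻¹).det = 1 := by rw [← map_mul]; simp
    rw [Matrix.det_mul, h, zero_mul] at this
    exact zero_ne_one this
  have htr : ∀ g, (ρ g).trace ^ m = m ^ m * (ρ g).det := by
    intro g
    have := hcon g
    rw [div_eq_iff (hdet g)] at this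
    simpa [hm] using this
  have htr0 : ∀ g, (ρ g).trace ≠ 0 := by
    intro g h
    have := htr g
    rw [h, zero_pow (by simp [hm])] at this
    exact mul_ne_zero (pow_ne_zero _ hm0) (hdet g) this.symm
  let F : G × G → ℂ := fun p => m * (ρ (p.1 * p.2)).trace / ((ρ p.1).trace * (ρ p.2).trace)
  have hF : Continuous F := by
    refine Continuous.div (by fun_prop) (by fun_prop) fun p => mul_ne_zero (htr0 _) (htr0 _)
  have hFpow : ∀ p, F p ^ m = 1 := by
    rintro ⟨g, h⟩
    simp only [F, div_pow, mul_pow, htr]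
    rw [map_mul, Matrix.det_mul]
    have := hdet g
    have := hdet h
    have := pow_ne_zero m hm0
    field_simp
  have hfin : (Set.range F).Countable := by
    refine Set.Finite.countable ((Polynomial.nthRootsFinset m (1 : ℂ)).finite_toSet.subset ?_)
    rintro _ ⟨p, rfl⟩
    rw [Finset.mem_coe, Polynomial.mem_nthRootsFinset (hm ▸ Fintype.card_pos)]
    exact hFpow p
  have hmul : ∀ g h, (m : ℂ) * (ρ g * ρ h).trace = (ρ g).trace * (ρ h).trace := by
    intro g h
    have h1 : F (g, h) = F (1, 1) :=
      hfin.isTotallyDisconnected _ subset_rfl (isPreconnected_range hF) ⟨_, rfl⟩ ⟨_, rfl⟩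
    have h2 : F (1, 1) = 1 := by
      simp only [F, mul_one, map_one, Matrix.trace_one, ← hm]
      exact div_self (mul_ne_zero hm0 hm0)
    rw [h2] at h1
    have := (div_eq_one_iff_eq (mul_ne_zero (htr0 g) (htr0 h))).1 h1
    rwa [map_mul] at this
  have hlin : ∀ g X, (m : ℂ) * (ρ g * X).trace = (ρ g).trace * X.trace := by
    intro g X
    have hX : X ∈ Submodule.span ℂ (Set.range ρ) := hspan ▸ Submodule.mem_top
    induction hX using Submodule.span_induction with
    | mem X hX => obtain ⟨h, rfl⟩ := hX; exact hmul g h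
    | zero => simp
    | add X Y _ _ hX hY => rw [Matrix.mul_add, Matrix.trace_add, Matrix.trace_add, mul_add, mul_add,
        hX, hY]
    | smul c X _ hX => rw [Matrix.mul_smul, Matrix.trace_smul, Matrix.trace_smul, smul_eq_mul,
        smul_eq_mul, mul_left_comm, hX, mul_left_comm]
  obtain ⟨i, j, hij⟩ := exists_pair_ne n
  have hoff : ∀ X : Matrix n n ℂ, X i j = 0 := by
    intro X
    have hX : X ∈ Submodule.span ℂ (Set.range ρ) := hspan ▸ Submodule.mem_top
    induction hX using Submodule.span_induction with
    | mem X hX =>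
      obtain ⟨g, rfl⟩ := hX
      have := hlin g (Matrix.single j i 1)
      rw [Matrix.trace_mul_single, Matrix.trace_single_eq_of_ne _ _ _ hij.symm] at this
      simpa [hm0] using this
    | zero => simp
    | add X Y _ _ hX hY => simp [hX, hY]
    | smul c X _ hX => simp [hX]
  simpa using hoff (Matrix.single i j 1)

theorem Subfield.countable_closure {K : Type*} [Field K] {s : Set K} (hs : s.Countable) :
    Countable (Subfield.closure s) := by
  rw [← Cardinal.mk_le_aleph0_iff]
  exact (Subfield.cardinalMk_closure_le_max s).trans
    (max_le (Cardinal.le_aleph0_iff_set_countable.2 hs) le_rfl)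

/-- A nonconstant continuous complex function on a connected space takes transcendental values over
any countable subfield. -/
theorem exists_not_isAlgebraic_of_continuous {X : Type*} [TopologicalSpace X] [PreconnectedSpace X]
    (K₀ : Subfield ℂ) [Countable K₀] {f : X → ℂ} (hf : Continuous f) {x y : X}
    (hxy : f x ≠ f y) : ∃ z, ¬ IsAlgebraic K₀ (f z) := by
  by_contra! h
  have hc : (Set.range f).Countable :=
    (Algebraic.countable K₀ ℂ).mono (by rintro _ ⟨z, rfl⟩; exact h z)
  exact hxy (hc.isTotallyDisconnected _ subset_rfl (isPreconnected_range hf) ⟨_, rfl⟩ ⟨_, rfl⟩)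

theorem Subfield.exists_valuationSubring_notMem {K : Type*} [Field K] (K₀ : Subfield K) {x : K}
    (hx : ¬ IsAlgebraic K₀ x) : ∃ O : ValuationSubring K, (K₀ : Set K) ⊆ O ∧ x ∉ O := by
  by_contra! h
  have h1 : x ∈ (⨅ V : {V : ValuationSubring K // (K₀ : Set K) ⊆ V.toSubring},
      V.1.toSubring) := by
    rw [Subring.mem_iInf]
    exact fun V => h V.1 V.2
  rw [iInf_valuationSubring_superset] at h1
  obtain ⟨p, hp, hpx⟩ := h1
  let φ : Subring.closure (K₀ : Set K) →+* K₀ :=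
    Subring.inclusion (T := K₀.toSubring) (Subring.closure_le.2 subset_rfl)
  refine hx (IsIntegral.isAlgebraic ⟨p.map φ, hp.map φ, ?_⟩)
  rw [Polynomial.eval₂_map]
  exact hpx

/-- Matrices `Z` over a subfield with `X * Z * Y = 0`, for fixed nonzero matrices `X` and `Y` over
another extension of the subfield, lie in a proper subspace of matrices. -/
theorem Subfield.exists_submodule_of_mul_map_mul_eq_zero {K F n : Type*} [Field K] [Field F]
    [Fintype n] [DecidableEq n] (K₀ : Subfield K) (res : K₀ →+* F) {X Y : Matrix n n F}
    (hX : X ≠ 0) (hY : Y ≠ 0) : ∃ W : Submodule K (Matrix n n K), W ≠ ⊤ ∧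
      ∀ Z : Matrix n n K₀, X * Z.map res * Y = 0 → Z.map K₀.subtype ∈ W := by
  let W₀ : Submodule K₀ (Matrix n n K₀) :=
    { carrier := {Z | X * Z.map res * Y = 0}
      zero_mem' := by simp
      add_mem' {a b} ha hb := by
        simp only [Set.mem_ofPred_eq] at ha hb ⊢
        rw [Matrix.map_add _ (map_add res), Matrix.mul_add, Matrix.add_mul, ha, hb, add_zero]
      smul_mem' c a ha := by
        simp only [Set.mem_ofPred_eq] at ha ⊢
        have : (c • a).map res = res c • a.map res := by ext; simp
        rw [this, Matrix.mul_smul, Matrix.smul_mul, ha, smul_zero] }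
  obtain ⟨W, hW, hW'⟩ := Submodule.exists_ne_top_of_subfield K₀ W₀ fun htop => by
    obtain ⟨a, b, hab⟩ : ∃ a b, X a b ≠ 0 := by
      by_contra! h
      exact hX (Matrix.ext h)
    obtain ⟨c, d, hcd⟩ : ∃ c d, Y c d ≠ 0 := by
      by_contra! h
      exact hY (Matrix.ext h)
    have h1 : Matrix.single b c (1 : K₀) ∈ W₀ := htop ▸ Submodule.mem_top
    have h2 : X * (Matrix.single b c (1 : K₀)).map res * Y = 0 := h1
    have h3 := congrFun (congrFun h2 a) d
    rw [Matrix.map_single _ _ _ res, map_one, Matrix.mul_assoc, Matrix.mul_apply,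
      Finset.sum_eq_single b] at h3
    · simp [hab, hcd] at h3
    · intro e _ he
      rw [Matrix.single_mul_apply_of_ne _ _ _ _ _ he, mul_zero]
    · simp
  exact ⟨W, hW, fun Z hZ => hW' Z hZ⟩

/-- A connected complex matrix group of degree at least two which spans the matrix algebra contains
free subgroups of every finite rank. -/
theorem exists_injective_freeGroup_of_span_eq_top {G n : Type*} [Group G] [TopologicalSpace G]
    [IsTopologicalGroup G] [ConnectedSpace G] [TopologicalSpace.SeparableSpace G]
    [Fintype n] [DecidableEq n] [Nontrivial n]
    (ρ : G →* Matrix n n ℂ) (hρ : Continuous ρ) (hspan : Submodule.span ℂ (Set.range ρ) = ⊤)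
    (k : ℕ) : ∃ f : FreeGroup (Fin k) →* G, Function.Injective f := by
  classical
  obtain ⟨D, hDc, hD⟩ := TopologicalSpace.exists_countable_dense G
  let G₀ := Subgroup.closure D
  have hG₀ : Dense (G₀ : Set G) := hD.mono Subgroup.subset_closure
  have : Countable D := hDc
  have : Countable G₀ := by
    have h : (FreeGroup.lift ((↑) : D → G)).range = G₀ := by
      rw [FreeGroup.range_lift_eq_closure, Subtype.range_coe]
    rw [← h]
    exact (FreeGroup.lift ((↑) : D → G)).rangeRestrict_surjective.countable
  let K₀ : Subfield ℂ := Subfield.closure (Set.range fun p : G₀ × n × n => ρ p.1 p.2.1 p.2.2)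
  have : Countable K₀ := Subfield.countable_closure (Set.countable_range _)
  have hK₀ : ∀ (z : G₀) i j, ρ z i j ∈ K₀ := fun z i j =>
    Subfield.subset_closure ⟨(z, i, j), rfl⟩
  have hone : ∀ g, ρ g * ρ g⁻¹ = 1 := fun g => by rw [← map_mul]; simp
  have hdet : ∀ g, (ρ g).det ≠ 0 := by
    intro g h
    have := congrArg Matrix.det (hone g)
    rw [Matrix.det_mul, h, zero_mul, Matrix.det_one] at this
    exact zero_ne_one this
  obtain ⟨g₁, hg₁⟩ := exists_trace_pow_div_det_ne ρ hρ hspan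
  obtain ⟨g, hg⟩ := exists_not_isAlgebraic_of_continuous K₀
    (f := fun g => (ρ g).trace ^ Fintype.card n / (ρ g).det)
    (Continuous.div (by fun_prop) (by fun_prop) hdet) hg₁
  obtain ⟨O, hKO, hgO⟩ := K₀.exists_valuationSubring_notMem hg
  let ι : K₀ →+* O := Subring.inclusion (S := K₀.toSubring) (T := O.toSubring) hKO
  let res : K₀ →+* IsLocalRing.ResidueField O := (IsLocalRing.residue O).comp ι
  obtain ⟨M₀, hM₀⟩ : ∃ M₀ : G₀ →* Matrix n n K₀, ∀ z, (M₀ z).map K₀.subtype = ρ z := by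
    have hinj := Matrix.map_injective (m := n) (n := n) (f := K₀.subtype) Subtype.val_injective
    refine ⟨{ toFun z := Matrix.of fun i j => ⟨ρ z i j, hK₀ z i j⟩
              map_one' := hinj ?_
              map_mul' x y := hinj ?_ }, fun z => rfl⟩
    · ext i j
      by_cases hij : i = j <;> simp [hij]
    · ext i j
      simp [Matrix.mul_apply]
  obtain ⟨R, hR⟩ : ∃ R : G₀ →* Matrix n n (IsLocalRing.ResidueField O),
      ∀ z, R z = (M₀ z).map res := ⟨res.mapMatrix.toMonoidHom.comp M₀, fun z => rfl⟩
  refine exists_injective_freeGroup_of_limits (fun g => Matrix.IsScaledReduction O (ρ g))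
    (fun g h A B hA hB => map_mul ρ g h ▸ hA.mul hB)
    (fun g => Matrix.IsScaledReduction.exists_ne_zero O fun h => ?_)
    (fun A hA h => Matrix.IsScaledReduction.rank_of_one (K := ℂ) (O := O) hA (map_one ρ ▸ h))
    ?_ G₀ R ?_ ?_ k
  · exact hdet g (by rw [h, Matrix.det_zero])
  · obtain ⟨A, hA, h⟩ := Matrix.IsScaledReduction.exists_ne_zero (M := ρ g) O fun h =>
      hdet g (by rw [h, Matrix.det_zero])
    exact ⟨g, A, h, hA, h.rank_lt hgO⟩
  · refine fun z => ⟨1, one_ne_zero, (M₀ z).map ι, ?_, (hR z).symm⟩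
    rw [one_smul, ← hM₀]
    rfl
  · intro s t ht
    have key : ∀ X Y : Matrix n n (IsLocalRing.ResidueField O), ∃ W : Submodule ℂ (Matrix n n ℂ),
        X ≠ 0 → Y ≠ 0 → W ≠ ⊤ ∧ ∀ Z : Matrix n n K₀,
          X * Z.map res * Y = 0 → Z.map K₀.subtype ∈ W := by
      intro X Y
      by_cases hXY : X ≠ 0 ∧ Y ≠ 0
      · obtain ⟨W, hW⟩ := K₀.exists_submodule_of_mul_map_mul_eq_zero res hXY.1 hXY.2
        exact ⟨W, fun _ _ => hW⟩
      · exact ⟨⊤, fun hX hY => (hXY ⟨hX, hY⟩).elim⟩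
    choose W hW using key
    obtain ⟨y, hy, hall⟩ := exists_mem_dense_forall_notMem ρ hρ hspan hG₀
      (s.map (Function.Embedding.subtype _)) ((t ×ˢ t).image fun p => W p.1 p.2) (by
        simp only [Finset.mem_image, Finset.mem_product, Prod.exists, forall_exists_index, and_imp]
        rintro _ X Y hX hY rfl
        exact (hW X Y (ht X hX) (ht Y hY)).1)
    refine ⟨⟨y, hy⟩, fun x hx X hX Y hY => ?_⟩
    obtain ⟨h1, h2⟩ := hall x (Finset.mem_map_of_mem (Function.Embedding.subtype _) hx) (W X Y)
      (Finset.mem_image.2 ⟨(X, Y), Finset.mem_product.2 ⟨hX, hY⟩, rfl⟩)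
    have hz : ∀ z : G₀, X * R z * Y = 0 → ρ z ∈ W X Y := fun z h => by
      rw [hR] at h
      exact hM₀ z ▸ (hW X Y (ht X hX) (ht Y hY)).2 _ h
    exact ⟨fun h => h1 (hz _ h), fun h => h2 (hz _ h)⟩

/-- Burnside's theorem on irreducible representations over an algebraically closed field. -/
theorem Representation.span_range_eq_top {k G V : Type*} [Field k] [IsAlgClosed k] [Monoid G]
    [AddCommGroup V] [Module k V] [FiniteDimensional k V] [Nontrivial V]
    (ρ : Representation k G V)
    (hirr : ∀ W : Submodule k V, (∀ g, W ≤ W.comap (ρ g)) → W = ⊥ ∨ W = ⊤) :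
    Submodule.span k (Set.range ρ) = ⊤ := by
  set A : Subalgebra k (Module.End k V) := Algebra.adjoin k (Set.range ρ) with hA
  have hρA : ∀ g, ρ g ∈ A := fun g => Algebra.subset_adjoin ⟨g, rfl⟩
  have : IsSimpleModule A V := by
    refine (isSimpleModule_iff ..).2 { eq_bot_or_eq_top := fun W => ?_ }
    have := hirr (W.restrictScalars k) fun g v hv => W.smul_mem (⟨ρ g, hρA g⟩ : A) hv
    simpa using this
  have hspan : Submodule.span k (Set.range ρ) = A.toSubmodule := by
    rw [hA, Algebra.adjoin_eq_span, ← MonoidHom.coe_mrange, Submonoid.closure_eq]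
  rw [hspan, eq_top_iff]
  intro f _
  let F : Module.End (Module.End A V) V :=
    { toFun := f
      map_add' := map_add f
      map_smul' := fun c v => by
        obtain ⟨a, rfl⟩ :=
          (IsSimpleModule.algebraMap_end_bijective_of_isAlgClosed (A := A) (V := V) k).2 c
        exact map_smul f a v }
  classical
  let b := Module.finBasis k V
  obtain ⟨r, hr⟩ := jacobson_density (R := A) F (Finset.univ.image b)
  have : f = r := b.ext fun i => hr (b i) (Finset.mem_image_of_mem b (Finset.mem_univ i))
  rw [this]
  exact r.2

theorem Representation.exists_injective_freeGroup_of_irreducible {G V : Type*} [Group G]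
    [TopologicalSpace G] [IsTopologicalGroup G] [ConnectedSpace G]
    [TopologicalSpace.SeparableSpace G] [AddCommGroup V] [Module ℂ V] [FiniteDimensional ℂ V]
    (ρ : Representation ℂ G V)
    (hρ : ∀ (v : V) (f : Module.Dual ℂ V), Continuous fun g => f (ρ g v))
    (hirr : ∀ W : Submodule ℂ V, (∀ g, W ≤ W.comap (ρ g)) → W = ⊥ ∨ W = ⊤)
    (hV : 1 < Module.finrank ℂ V) (k : ℕ) :
    ∃ f : FreeGroup (Fin k) →* G, Function.Injective f := by
  have : Nontrivial V := Module.nontrivial_of_finrank_pos (R := ℂ) (by omega)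
  have : Nontrivial (Fin (Module.finrank ℂ V)) := Fin.nontrivial_iff_two_le.2 hV
  let b := Module.finBasis ℂ V
  let e := LinearMap.toMatrixAlgEquiv b
  refine exists_injective_freeGroup_of_span_eq_top (e.toAlgHom.toMonoidHom.comp ρ) ?_ ?_ k
  · refine continuous_matrix fun i j => ?_
    have := hρ (b j) (b.coord i)
    simpa [e, LinearMap.toMatrixAlgEquiv_apply] using this
  · have h := congrArg (Submodule.map e.toLinearMap) (ρ.span_range_eq_top hirr)
    rw [Submodule.map_span, Submodule.map_top, ← Set.range_comp] at h
    exact h.trans (LinearMap.range_eq_top.2 e.surjective)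

/-- If a subgroup acts trivially on an invariant subspace and on the quotient by it, then its
commutator subgroup acts trivially. -/
theorem Representation.commutator_le_ker_of_le {k G V : Type*} [Ring k] [Group G]
    [AddCommGroup V] [Module k V] (ρ : Representation k G V) (W : Submodule k V) (hW : ∀ g, W ≤ W.comap (ρ g)) (D : Subgroup G)
    (h1 : D ≤ (ρ.subrepresentation W hW).ker) (h2 : D ≤ (ρ.quotient W hW).ker) :
    ⁅D, D⁆ ≤ ρ.ker := by
  have hsub : ∀ g ∈ D, ∀ w ∈ W, ρ g w = w := fun g hg w hw => by
    simpa using congrArg Subtype.val (LinearMap.congr_fun (MonoidHom.mem_ker.1 (h1 hg)) ⟨w, hw⟩)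
  have hquot : ∀ g ∈ D, ∀ v, ρ g v - v ∈ W := fun g hg v => by
    have := LinearMap.congr_fun (MonoidHom.mem_ker.1 (h2 hg)) (W.mkQ v)
    exact (Submodule.Quotient.eq W).1 this
  have hcomm : ∀ x ∈ D, ∀ y ∈ D, ρ (x * y) = ρ (y * x) := fun x hx y hy => by
    ext v
    have hx' := hsub y hy _ (hquot x hx v)
    have hy' := hsub x hx _ (hquot y hy v)
    rw [map_sub] at hx' hy'
    simp only [map_mul, Module.End.mul_apply]
    rw [sub_eq_iff_eq_add.1 hx', sub_eq_iff_eq_add.1 hy']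
    abel
  refine Subgroup.commutator_le.2 fun x hx y hy => ?_
  rw [MonoidHom.mem_ker, commutatorElement_def, mul_assoc, ← mul_inv_rev, map_mul,
    hcomm x hx y hy, ← map_mul, mul_inv_cancel, map_one]

/-- A continuous finite-dimensional representation of a connected group without free subgroups
of some finite rank has solvable image. -/
theorem Representation.exists_derivedSeries_le_ker {G : Type*} [Group G]
    [TopologicalSpace G] [IsTopologicalGroup G] [ConnectedSpace G]
    [TopologicalSpace.SeparableSpace G] {k : ℕ}
    (hG : ¬ ∃ f : FreeGroup (Fin k) →* G, Function.Injective f)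
    {V : Type*} [AddCommGroup V] [Module ℂ V] [FiniteDimensional ℂ V]
    (ρ : Representation ℂ G V)
    (hρ : ∀ (v : V) (f : Module.Dual ℂ V), Continuous fun g => f (ρ g v)) :
    ∃ m, derivedSeries G m ≤ ρ.ker := by
  induction hd : Module.finrank ℂ V using Nat.strong_induction_on generalizing V with
  | _ d ih =>
    by_cases hirr : ∀ W : Submodule ℂ V, (∀ g, W ≤ W.comap (ρ g)) → W = ⊥ ∨ W = ⊤
    · have hV : Module.finrank ℂ V ≤ 1 := not_lt.1 fun h =>
        hG (ρ.exists_injective_freeGroup_of_irreducible hρ hirr h k)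
      refine ⟨1, Subgroup.commutator_le.2 fun x _ y _ => ?_⟩
      have hcomm : ρ (x * y) = ρ (y * x) := by
        obtain ⟨v, hv⟩ := finrank_le_one_iff.1 hV
        obtain ⟨a, ha⟩ := hv (ρ x v)
        obtain ⟨b, hb⟩ := hv (ρ y v)
        ext w
        obtain ⟨c, rfl⟩ := hv w
        simp only [map_mul, Module.End.mul_apply, map_smul, ← ha, ← hb, smul_comm a b]
      rw [MonoidHom.mem_ker, commutatorElement_def, mul_assoc, ← mul_inv_rev, map_mul,
        hcomm, ← map_mul, mul_inv_cancel, map_one]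
    · push Not at hirr
      obtain ⟨W, hW, hbot, htop⟩ := hirr
      have hlt : Module.finrank ℂ W < Module.finrank ℂ V := Submodule.finrank_lt htop
      have hpos : 0 < Module.finrank ℂ W := Submodule.one_le_finrank_iff.2 hbot
      have hadd := W.finrank_quotient_add_finrank
      obtain ⟨m₁, h₁⟩ := ih _ (hd ▸ hlt) (ρ.subrepresentation W hW) (fun v f => by
        obtain ⟨f', rfl⟩ := f.exists_extend
        exact hρ v f') rfl
      obtain ⟨m₂, h₂⟩ := ih (Module.finrank ℂ (V ⧸ W)) (by omega) (ρ.quotient W hW)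
        (fun v f => by
          obtain ⟨v, rfl⟩ := W.mkQ_surjective v
          exact hρ v (f ∘ₗ W.mkQ)) rfl
      exact ⟨max m₁ m₂ + 1, ρ.commutator_le_ker_of_le W hW _
        ((derivedSeries_antitone G (le_max_left _ _)).trans h₁)
        ((derivedSeries_antitone G (le_max_right _ _)).trans h₂)⟩

/-- A subgroup of `GL(n, ℝ)` that is connected (in the subspace topology)
and not solvable contains a free subgroup of rank `k` for every `k`. -/
theorem stmt_1 (n : ℕ) (G : Subgroup (GL (Fin n) ℝ))
    (hconn : IsConnected (G : Set (GL (Fin n) ℝ)))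
    (hsolv : ¬ IsSolvable G) (k : ℕ) :
    ∃ f : FreeGroup (Fin k) →* G, Function.Injective f := by
  by_contra hG
  have : ConnectedSpace G := isConnected_iff_connectedSpace.1 hconn
  have : SecondCountableTopology (Matrix (Fin n) (Fin n) ℝ) :=
    inferInstanceAs (SecondCountableTopology (Fin n → Fin n → ℝ))
  have : SecondCountableTopology (Matrix (Fin n) (Fin n) ℝ)ᵐᵒᵖ :=
    MulOpposite.opHomeomorph.symm.secondCountableTopology
  have : SecondCountableTopology (GL (Fin n) ℝ) :=
    Units.isEmbedding_embedProduct.secondCountableTopology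
  have : SecondCountableTopology G := TopologicalSpace.Subtype.secondCountableTopology _
  have : TopologicalSpace.SeparableSpace G := inferInstance
  let φ : GL (Fin n) ℝ →* Module.End ℂ (Fin n → ℂ) :=
    (Matrix.toLinAlgEquiv' : Matrix (Fin n) (Fin n) ℂ ≃ₐ[ℂ] _).toMonoidHom.comp
      ((algebraMap ℝ ℂ).mapMatrix.toMonoidHom.comp (Units.coeHom _))
  have hφ : Function.Injective φ :=
    (Matrix.toLinAlgEquiv' : Matrix (Fin n) (Fin n) ℂ ≃ₐ[ℂ] _).injective.comp
      ((Matrix.map_injective (algebraMap ℝ ℂ).injective).comp Units.val_injective)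
  obtain ⟨m, hm⟩ := Representation.exists_derivedSeries_le_ker hG (φ.comp G.subtype)
    fun v f => by
      have hc : Continuous fun g : G =>
          (g : GL (Fin n) ℝ).val.map (algebraMap ℝ ℂ) :=
        (Units.continuous_val.comp continuous_subtype_val).matrix_map Complex.continuous_ofReal
      exact (LinearMap.continuous_of_finiteDimensional f).comp
        (hc.matrix_mulVec continuous_const)
  refine hsolv ⟨m, ?_⟩
  rw [eq_bot_iff]
  refine hm.trans (le_of_eq ?_)
  exact (MonoidHom.ker_eq_bot_iff _).2 (hφ.comp G.subtype_injective)
end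

section
/- Let γ and γ₁, γ₂, … be C^∞ curves ℝ → ℝ^d such that for every k ≥ 0 the k-th derivatives γ_n^{(k)} converge uniformly on [0,1] to γ^{(k)}. Then there exist a strictly increasing map σ : ℕ → ℕ and a function φ : ℝ × ℝ → ℝ^d that is C^∞ on (−1,1) × [0,1], such that φ(s, t) = γ(t) for all s ≤ 0 and t ∈ [0,1], and φ(2^{−n}, t) = γ_{σ(n)}(t) for all n ≥ 1 and t ∈ [0,1]. -/
open Set Filter Topology

theorem iteratedDeriv_eq_zero_of_notMem_tsupport {F : Type*} [NormedAddCommGroup F]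
    [NormedSpace ℝ F] {f : ℝ → F} {x : ℝ} (hx : x ∉ tsupport f) (n : ℕ) :
    iteratedDeriv n f x = 0 := by
  have h : iteratedFDeriv ℝ n f x = 0 := by
    by_contra h
    exact hx (support_iteratedFDeriv_subset n h)
  simp [iteratedDeriv, h]

section DyadicSeries

variable {E : Type*} [NormedAddCommGroup E] [NormedSpace ℝ E]

/-- The series of products of the `j`-th derivatives of `u n` in the first variable and the
`k`-th derivatives of `f n` in the second. -/
noncomputable def mixedDerivSeries (u : ℕ → ℝ → ℝ) (f : ℕ → ℝ → E) (j k : ℕ) (p : ℝ × ℝ) : E :=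
  ∑' n, iteratedDeriv j (u n) p.1 • iteratedDeriv k (f n) p.2

variable {u : ℕ → ℝ → ℝ} {f : ℕ → ℝ → E} {K : Set ℝ}

theorem iteratedDeriv_eq_zero_of_lt_dyadic
    (hsupp : ∀ n, tsupport (u n) ⊆ Icc ((1 / 2) ^ n / 2) (3 / 2 * (1 / 2) ^ n))
    {n : ℕ} {s : ℝ} (hs : s < (1 / 2) ^ n / 2) (j : ℕ) : iteratedDeriv j (u n) s = 0 :=
  iteratedDeriv_eq_zero_of_notMem_tsupport (fun h => hs.not_ge (hsupp n h).1) j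

theorem iteratedDeriv_eq_zero_of_dyadic_lt
    (hsupp : ∀ n, tsupport (u n) ⊆ Icc ((1 / 2) ^ n / 2) (3 / 2 * (1 / 2) ^ n))
    {n : ℕ} {s : ℝ} (hs : 3 / 2 * (1 / 2) ^ n < s) (j : ℕ) : iteratedDeriv j (u n) s = 0 :=
  iteratedDeriv_eq_zero_of_notMem_tsupport (fun h => hs.not_ge (hsupp n h).2) j

theorem mixedDerivSeries_of_nonpos
    (hsupp : ∀ n, tsupport (u n) ⊆ Icc ((1 / 2) ^ n / 2) (3 / 2 * (1 / 2) ^ n))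
    (j k : ℕ) {p : ℝ × ℝ} (hp : p.1 ≤ 0) : mixedDerivSeries u f j k p = 0 := by
  have h (n : ℕ) : iteratedDeriv j (u n) p.1 = 0 :=
    iteratedDeriv_eq_zero_of_lt_dyadic hsupp (hp.trans_lt (by positivity)) j
  simp [mixedDerivSeries, h]

theorem exists_mixedDerivSeries_eq_sum
    (hsupp : ∀ n, tsupport (u n) ⊆ Icc ((1 / 2) ^ n / 2) (3 / 2 * (1 / 2) ^ n))
    {s₀ : ℝ} (hs₀ : 0 < s₀) :
    ∃ N : ℕ, ∀ j k, ∀ p : ℝ × ℝ, s₀ < p.1 → mixedDerivSeries u f j k p =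
      ∑ n ∈ Finset.range N, iteratedDeriv j (u n) p.1 • iteratedDeriv k (f n) p.2 := by
  obtain ⟨N, hN⟩ := exists_pow_lt_of_lt_one (show 0 < 2 / 3 * s₀ by positivity)
    (show (1 / 2 : ℝ) < 1 by norm_num)
  refine ⟨N, fun j k p hp => tsum_eq_sum fun n hn => ?_⟩
  have hn : N ≤ n := by simpa using hn
  have h : (1 / 2 : ℝ) ^ n ≤ (1 / 2) ^ N := pow_le_pow_of_le_one (by norm_num) (by norm_num) hn
  rw [iteratedDeriv_eq_zero_of_dyadic_lt hsupp (by linarith), zero_smul]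

theorem norm_mixedDerivSeries_le
    (hsupp : ∀ n, tsupport (u n) ⊆ Icc ((1 / 2) ^ n / 2) (3 / 2 * (1 / 2) ^ n))
    (hbound : ∀ n, ∀ j ≤ n, ∀ k ≤ n, ∀ s, ∀ t ∈ K,
      ‖iteratedDeriv j (u n) s • iteratedDeriv k (f n) t‖ ≤ (1 / 2) ^ n * s ^ 2)
    (j k : ℕ) {p : ℝ × ℝ} (hp : p.1 < (1 / 2) ^ max j k / 2) (hpK : p.2 ∈ K) :
    ‖mixedDerivSeries u f j k p‖ ≤ 2 * p.1 ^ 2 := by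
  refine tsum_of_norm_bounded ((hasSum_geometric_two).mul_right (p.1 ^ 2)) fun n => ?_
  rcases le_total (max j k) n with hn | hn
  · exact hbound n j ((le_max_left _ _).trans hn) k ((le_max_right _ _).trans hn) _ _ hpK
  · have h : (1 / 2 : ℝ) ^ max j k ≤ (1 / 2) ^ n :=
      pow_le_pow_of_le_one (by norm_num) (by norm_num) hn
    rw [iteratedDeriv_eq_zero_of_lt_dyadic hsupp (by linarith), zero_smul, norm_zero]
    positivity

/-- The differential of `mixedDerivSeries u f j k`. -/
noncomputable def mixedDerivSeriesFDeriv (u : ℕ → ℝ → ℝ) (f : ℕ → ℝ → E) (j k : ℕ)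
    (p : ℝ × ℝ) : ℝ × ℝ →L[ℝ] E :=
  (ContinuousLinearMap.fst ℝ ℝ ℝ).smulRight (mixedDerivSeries u f (j + 1) k p) +
    (ContinuousLinearMap.snd ℝ ℝ ℝ).smulRight (mixedDerivSeries u f j (k + 1) p)

theorem hasFDerivWithinAt_mixedDerivSeries
    (hu : ∀ n, ContDiff ℝ (⊤ : ℕ∞) (u n)) (hf : ∀ n, ContDiff ℝ (⊤ : ℕ∞) (f n))
    (hsupp : ∀ n, tsupport (u n) ⊆ Icc ((1 / 2) ^ n / 2) (3 / 2 * (1 / 2) ^ n))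
    (hbound : ∀ n, ∀ j ≤ n, ∀ k ≤ n, ∀ s, ∀ t ∈ K,
      ‖iteratedDeriv j (u n) s • iteratedDeriv k (f n) t‖ ≤ (1 / 2) ^ n * s ^ 2)
    (j k : ℕ) (p : ℝ × ℝ) :
    HasFDerivWithinAt (mixedDerivSeries u f j k) (mixedDerivSeriesFDeriv u f j k p)
      (univ ×ˢ K) p := by
  rcases lt_trichotomy p.1 0 with h0 | h0 | h0
  · have hev : mixedDerivSeries u f j k =ᶠ[𝓝 p] fun _ => 0 := by
      filter_upwards [(isOpen_Iio.preimage continuous_fst).mem_nhds h0] with q hq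
      exact mixedDerivSeries_of_nonpos hsupp j k (le_of_lt hq)
    have hD : mixedDerivSeriesFDeriv u f j k p = 0 := by
      simp [mixedDerivSeriesFDeriv, mixedDerivSeries_of_nonpos hsupp _ _ h0.le]
    rw [hD]
    exact ((hasFDerivAt_const (0 : E) p).congr_of_eventuallyEq hev).hasFDerivWithinAt
  · have hD : mixedDerivSeriesFDeriv u f j k p = 0 := by
      simp [mixedDerivSeriesFDeriv, mixedDerivSeries_of_nonpos hsupp _ _ h0.le]
    rw [hD, hasFDerivWithinAt_iff_isLittleO, mixedDerivSeries_of_nonpos hsupp _ _ h0.le]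
    simp only [sub_zero, zero_apply]
    have hO : mixedDerivSeries u f j k =O[𝓝[univ ×ˢ K] p] fun q => ‖q - p‖ ^ 2 := by
      refine Asymptotics.IsBigO.of_bound 2 ?_
      have hlt : ∀ᶠ q : ℝ × ℝ in 𝓝[univ ×ˢ K] p, q.1 < (1 / 2) ^ max j k / 2 :=
        nhdsWithin_le_nhds ((isOpen_Iio.preimage continuous_fst).mem_nhds
          (by simp only [mem_preimage, mem_Iio, h0]; positivity))
      filter_upwards [hlt, self_mem_nhdsWithin] with q hq hqK
      refine (norm_mixedDerivSeries_le hsupp hbound j k hq hqK.2).trans ?_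
      have h1 : |q.1| ≤ ‖q - p‖ := by
        simpa [h0] using norm_fst_le (q - p)
      rw [norm_pow, norm_norm, ← sq_abs q.1]
      gcongr
    refine hO.trans_isLittleO ?_
    have hlim : Tendsto (fun q : ℝ × ℝ => q - p) (𝓝[univ ×ˢ K] p) (𝓝 0) := by
      have : Continuous fun q : ℝ × ℝ => q - p := by fun_prop
      simpa using (this.tendsto p).mono_left nhdsWithin_le_nhds
    exact (Asymptotics.isLittleO_norm_pow_id one_lt_two).comp_tendsto hlim
  · obtain ⟨N, hN⟩ := exists_mixedDerivSeries_eq_sum (f := f) hsupp (half_pos h0)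
    have hev : mixedDerivSeries u f j k =ᶠ[𝓝 p] fun q =>
        ∑ n ∈ Finset.range N, iteratedDeriv j (u n) q.1 • iteratedDeriv k (f n) q.2 := by
      filter_upwards [(isOpen_Ioi.preimage continuous_fst).mem_nhds (half_lt_self h0)] with q hq
      exact hN j k q hq
    have hterm (n : ℕ) : HasFDerivAt
        (fun q : ℝ × ℝ => iteratedDeriv j (u n) q.1 • iteratedDeriv k (f n) q.2)
        ((ContinuousLinearMap.fst ℝ ℝ ℝ).smulRight
            (iteratedDeriv (j + 1) (u n) p.1 • iteratedDeriv k (f n) p.2) +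
          (ContinuousLinearMap.snd ℝ ℝ ℝ).smulRight
            (iteratedDeriv j (u n) p.1 • iteratedDeriv (k + 1) (f n) p.2)) p := by
      have hu' : HasDerivAt (iteratedDeriv j (u n)) (iteratedDeriv (j + 1) (u n) p.1) p.1 := by
        rw [iteratedDeriv_succ]
        exact ((hu n).differentiable_iteratedDeriv j
          (mod_cast WithTop.coe_lt_top _)).differentiableAt.hasDerivAt
      have hf' : HasDerivAt (iteratedDeriv k (f n)) (iteratedDeriv (k + 1) (f n) p.2) p.2 := by
        rw [iteratedDeriv_succ]
        exact ((hf n).differentiable_iteratedDeriv k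
          (mod_cast WithTop.coe_lt_top _)).differentiableAt.hasDerivAt
      refine ((hu'.hasFDerivAt.comp p hasFDerivAt_fst).smul
        (hf'.hasFDerivAt.comp p hasFDerivAt_snd)).congr_fderiv ?_
      ext <;> simp
    have hsum := HasFDerivAt.fun_sum (u := Finset.range N) fun n _ => hterm n
    refine ((hsum.congr_of_eventuallyEq hev).congr_fderiv ?_).hasFDerivWithinAt
    rw [mixedDerivSeriesFDeriv, hN _ _ p (half_lt_self h0), hN _ _ p (half_lt_self h0)]
    ext <;> simp

theorem contDiffOn_mixedDerivSeries (hK : UniqueDiffOn ℝ K)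
    (hu : ∀ n, ContDiff ℝ (⊤ : ℕ∞) (u n)) (hf : ∀ n, ContDiff ℝ (⊤ : ℕ∞) (f n))
    (hsupp : ∀ n, tsupport (u n) ⊆ Icc ((1 / 2) ^ n / 2) (3 / 2 * (1 / 2) ^ n))
    (hbound : ∀ n, ∀ j ≤ n, ∀ k ≤ n, ∀ s, ∀ t ∈ K,
      ‖iteratedDeriv j (u n) s • iteratedDeriv k (f n) t‖ ≤ (1 / 2) ^ n * s ^ 2)
    (j k : ℕ) : ContDiffOn ℝ (⊤ : ℕ∞) (mixedDerivSeries u f j k) (univ ×ˢ K) := by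
  rw [contDiffOn_infty]
  intro m
  induction m generalizing j k with
  | zero =>
    exact contDiffOn_zero.2 fun p _ =>
      (hasFDerivWithinAt_mixedDerivSeries hu hf hsupp hbound j k p).continuousWithinAt
  | succ m ih =>
    push_cast
    rw [contDiffOn_succ_iff_hasFDerivWithinAt_of_uniqueDiffOn (uniqueDiffOn_univ.prod hK)]
    refine ⟨by simp, mixedDerivSeriesFDeriv u f j k, ?_, fun p _ =>
      hasFDerivWithinAt_mixedDerivSeries hu hf hsupp hbound j k p⟩
    exact (contDiffOn_const.smulRight (ih (j + 1) k)).add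
      (contDiffOn_const.smulRight (ih j (k + 1)))

end DyadicSeries

/-- A bump function equal to `1` near `2⁻ⁿ` and supported in `[2⁻ⁿ / 2, 3 / 2 * 2⁻ⁿ]`. -/
noncomputable def dyadicBump (n : ℕ) : ContDiffBump ((1 / 2 : ℝ) ^ n) where
  rIn := (1 / 2) ^ n / 4
  rOut := (1 / 2) ^ n / 2
  rIn_pos := by positivity
  rIn_lt_rOut := by
    have : (0 : ℝ) < (1 / 2) ^ n := by positivity
    linarith

theorem tsupport_dyadicBump (n : ℕ) :
    tsupport (dyadicBump n) = Icc ((1 / 2) ^ n / 2) (3 / 2 * (1 / 2) ^ n) := by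
  rw [ContDiffBump.tsupport_eq, Real.closedBall_eq_Icc]
  congr 1 <;> simp only [dyadicBump] <;> ring

theorem dyadicBump_self (n : ℕ) : dyadicBump n ((1 / 2) ^ n) = 1 :=
  (dyadicBump n).one_of_mem_closedBall (Metric.mem_closedBall_self (dyadicBump n).rIn_pos.le)

theorem dyadicBump_of_ne {m n : ℕ} (h : m ≠ n) : dyadicBump m ((1 / 2) ^ n) = 0 := by
  refine (dyadicBump m).zero_of_le_dist ?_
  change (1 / 2 : ℝ) ^ m / 2 ≤ |(1 / 2) ^ n - (1 / 2) ^ m|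
  have hpos : (0 : ℝ) < (1 / 2) ^ m := by positivity
  rcases lt_or_gt_of_ne h with h | h
  · have : (1 / 2 : ℝ) ^ n ≤ (1 / 2) ^ (m + 1) :=
      pow_le_pow_of_le_one (by norm_num) (by norm_num) h
    rw [pow_succ] at this
    rw [le_abs]
    right
    linarith
  · have : (1 / 2 : ℝ) ^ m ≤ (1 / 2) ^ (n + 1) :=
      pow_le_pow_of_le_one (by norm_num) (by norm_num) h
    rw [pow_succ] at this
    rw [le_abs]
    left
    linarith

theorem exists_bound_iteratedDeriv_dyadicBump (n : ℕ) :
    ∃ C > 0, ∀ j ≤ n, ∀ s, ‖iteratedDeriv j (dyadicBump n) s‖ ≤ C * s ^ 2 := by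
  have hsupp (j : ℕ) : ∃ C > 0, ∀ s, ‖iteratedDeriv j (dyadicBump n) s‖ ≤ C := by
    have hc : Continuous (iteratedDeriv j (dyadicBump n)) :=
      ((dyadicBump n).contDiff (n := (j : ℕ∞))).continuous_iteratedDeriv j le_rfl
    have hcs : HasCompactSupport (iteratedDeriv j (dyadicBump n)) :=
      HasCompactSupport.intro (dyadicBump n).hasCompactSupport fun s hs =>
        iteratedDeriv_eq_zero_of_notMem_tsupport hs j
    obtain ⟨C, hC⟩ := hcs.exists_bound_of_continuous hc
    exact ⟨max C 1, by positivity, fun s => (hC s).trans (le_max_left _ _)⟩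
  choose C hC0 hC using hsupp
  refine ⟨(∑ j ∈ Finset.range (n + 1), C j) / ((1 / 2) ^ n / 2) ^ 2, ?_, fun j hj s => ?_⟩
  · have := Finset.sum_pos (fun j (_ : j ∈ Finset.range (n + 1)) => hC0 j) (by simp)
    positivity
  · by_cases hs : s ∈ tsupport (dyadicBump n)
    · rw [tsupport_dyadicBump] at hs
      have h1 : C j ≤ ∑ j ∈ Finset.range (n + 1), C j :=
        Finset.single_le_sum (fun i _ => (hC0 i).le) (by simpa [Nat.lt_succ_iff] using hj)
      have h2 : ((1 / 2 : ℝ) ^ n / 2) ^ 2 ≤ s ^ 2 := by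
        gcongr
        exact hs.1
      rw [div_mul_eq_mul_div, le_div_iff₀ (by positivity)]
      exact mul_le_mul ((hC j s).trans h1) h2 (by positivity) ((hC0 j).le.trans h1)
    · rw [iteratedDeriv_eq_zero_of_notMem_tsupport hs, norm_zero]
      have := Finset.sum_nonneg (fun j (_ : j ∈ Finset.range (n + 1)) => (hC0 j).le)
      positivity

/-- If smooth curves `γ n : ℝ → ℝ^d` converge to `γ₀` in the `C^∞`
topology (uniform convergence on `[0,1]` of all derivatives), then there is a
subsequence `γ ∘ σ` and a homotopy `φ`, smooth on `(-1,1) × [0,1]`, with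
`φ (s, ·) = γ₀` for `s ≤ 0` and `φ (2⁻ⁿ, ·) = γ (σ n)` for `n ≥ 1`. -/
theorem stmt_6 (d : ℕ) (γ₀ : ℝ → EuclideanSpace ℝ (Fin d))
    (γ : ℕ → ℝ → EuclideanSpace ℝ (Fin d))
    (hγ₀ : ContDiff ℝ (⊤ : ℕ∞) γ₀) (hγ : ∀ n, ContDiff ℝ (⊤ : ℕ∞) (γ n))
    (hconv : ∀ k : ℕ, TendstoUniformlyOn (fun n => iteratedDeriv k (γ n))
      (iteratedDeriv k γ₀) Filter.atTop (Set.Icc (0:ℝ) 1)) :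
    ∃ σ : ℕ → ℕ, StrictMono σ ∧ ∃ φ : ℝ × ℝ → EuclideanSpace ℝ (Fin d),
      ContDiffOn ℝ (⊤ : ℕ∞) φ (Set.Ioo (-1 : ℝ) 1 ×ˢ Set.Icc (0:ℝ) 1) ∧
      (∀ s ≤ (0:ℝ), ∀ t ∈ Set.Icc (0:ℝ) 1, φ (s, t) = γ₀ t) ∧
      (∀ n : ℕ, 1 ≤ n → ∀ t ∈ Set.Icc (0:ℝ) 1, φ ((1/2 : ℝ) ^ n, t) = γ (σ n) t) := by
  choose C hC0 hC using exists_bound_iteratedDeriv_dyadicBump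
  obtain ⟨σ, hσ, hclose⟩ : ∃ σ : ℕ → ℕ, StrictMono σ ∧ ∀ n, ∀ k ≤ n, ∀ t ∈ Icc (0 : ℝ) 1,
      ‖iteratedDeriv k (γ (σ n)) t - iteratedDeriv k γ₀ t‖ ≤ (1 / 2) ^ n / C n := by
    refine extraction_forall_of_eventually
      (P := fun n m => ∀ k ≤ n, ∀ t ∈ Icc (0 : ℝ) 1,
        ‖iteratedDeriv k (γ m) t - iteratedDeriv k γ₀ t‖ ≤ (1 / 2) ^ n / C n) fun n => ?_
    refine (eventually_all_finite (finite_Iic n)).2 fun k _ => ?_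
    have hpos : 0 < (1 / 2 : ℝ) ^ n / C n := div_pos (by positivity) (hC0 n)
    filter_upwards [Metric.tendstoUniformlyOn_iff.1 (hconv k) _ hpos] with m hm t ht
    rw [← dist_eq_norm, dist_comm]
    exact (hm t ht).le
  set f : ℕ → ℝ → EuclideanSpace ℝ (Fin d) := fun n => γ (σ n) - γ₀ with hf_def
  set u : ℕ → ℝ → ℝ := fun n => dyadicBump n with hu_def
  have hf (n : ℕ) : ContDiff ℝ (⊤ : ℕ∞) (f n) := (hγ (σ n)).sub hγ₀
  have hu (n : ℕ) : ContDiff ℝ (⊤ : ℕ∞) (u n) := (dyadicBump n).contDiff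
  have hsupp (n : ℕ) : tsupport (u n) ⊆ Icc ((1 / 2) ^ n / 2) (3 / 2 * (1 / 2) ^ n) :=
    (tsupport_dyadicBump n).subset
  have hbound : ∀ n, ∀ j ≤ n, ∀ k ≤ n, ∀ s, ∀ t ∈ Icc (0 : ℝ) 1,
      ‖iteratedDeriv j (u n) s • iteratedDeriv k (f n) t‖ ≤ (1 / 2) ^ n * s ^ 2 := by
    intro n j hj k hk s t ht
    have hk' : (k : WithTop ℕ∞) ≤ ((⊤ : ℕ∞) : WithTop ℕ∞) := mod_cast le_top
    rw [norm_smul, hf_def, iteratedDeriv_sub ((hγ (σ n)).of_le hk').contDiffAt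
      (hγ₀.of_le hk').contDiffAt]
    have hC' := hC0 n
    calc _ ≤ (C n * s ^ 2) * ((1 / 2) ^ n / C n) :=
          mul_le_mul (hC n j hj s) (hclose n k hk t ht) (norm_nonneg _) (by positivity)
      _ = (1 / 2) ^ n * s ^ 2 := by field_simp
  refine ⟨σ, hσ, fun p => γ₀ p.2 + mixedDerivSeries u f 0 0 p, ?_, fun s hs t _ => ?_,
    fun n _ t _ => ?_⟩
  · exact (hγ₀.comp contDiff_snd).contDiffOn.add
      ((contDiffOn_mixedDerivSeries (uniqueDiffOn_Icc zero_lt_one) hu hf hsupp hbound 0 0).mono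
        (prod_mono (subset_univ _) Subset.rfl))
  · simp [mixedDerivSeries_of_nonpos (f := f) hsupp 0 0 (p := (s, t)) hs]
  · have hsum : mixedDerivSeries u f 0 0 ((1 / 2) ^ n, t) = f n t := by
      rw [mixedDerivSeries, tsum_eq_single n fun m hm => ?_]
      · simp only [iteratedDeriv_zero, hu_def, dyadicBump_self, one_smul]
      · simp only [iteratedDeriv_zero, hu_def, dyadicBump_of_ne hm, zero_smul]
    change γ₀ t + mixedDerivSeries u f 0 0 ((1 / 2) ^ n, t) = γ (σ n) t
    rw [hsum]
    simp [hf_def]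
end
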